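/- Let n ≥ 2 be an integer and let f be a bounded continuous function on [0,∞) with f ∈ W²_0(ψ) and D̃f ∈ W²(ψ). Then ‖Ṽ_n f − f‖ ≤ (1/n²)·‖D̃²f‖. -/

import Mathlib

open MeasureTheory Filter Set

/-- Baskakov basis functions `P_{n,k}(x)`, with `P_{n,k} := 0` for `k < 0`. -/
noncomputable def P (n : ℕ) (k : ℤ) (x : ℝ) : ℝ :=
  if k < 0 then 0
  else (Nat.choose (n + k.toNat - 1) k.toNat : ℝ) * x ^ k.toNat * (1 + x) ^ (-(n : ℤ) - k)

/-- The weight `ψ(x) = x(1+x)`. -/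
noncomputable def psi (x : ℝ) : ℝ := x * (1 + x)

/-- The differential operator `D̃ f = ψ f''`. -/
noncomputable def Dt (f : ℝ → ℝ) : ℝ → ℝ := fun x => psi x * deriv (deriv f) x

/-- The functionals `v_{n,k}`. -/
noncomputable def v (n k : ℕ) (f : ℝ → ℝ) : ℝ :=
  if k = 0 then f 0
  else ((n : ℝ) + 1) * ∫ t in Set.Ioi (0 : ℝ), P (n + 2) ((k : ℤ) - 1) t * f t

/-- The Goodman–Sharma–Baskakov operator `V_n`. -/
noncomputable def V (n : ℕ) (f : ℝ → ℝ) (x : ℝ) : ℝ :=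
  ∑' k : ℕ, v n k f * P n (k : ℤ) x

/-- The modified operator `Ṽ_n`. -/
noncomputable def Vt (n : ℕ) (f : ℝ → ℝ) (x : ℝ) : ℝ :=
  ∑' k : ℕ, v n k f * (P n (k : ℤ) x - (1 / (n : ℝ)) * Dt (P n (k : ℤ)) x)

/-- Supremum norm on `[0,∞)`. -/
noncomputable def supNorm (f : ℝ → ℝ) : ℝ := ⨆ x ∈ Set.Ici (0 : ℝ), |f x|

/-- `f` is bounded and continuous on `[0,∞)`. -/
def BddContOn (f : ℝ → ℝ) : Prop :=
  ContinuousOn f (Set.Ici 0) ∧ ∃ M, ∀ x ∈ Set.Ici (0 : ℝ), |f x| ≤ M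

/-- The space `W²(ψ)`: `g, g'` (locally) differentiable on `(0,∞)` and `D̃ g` bounded. -/
def MemW2 (g : ℝ → ℝ) : Prop :=
  DifferentiableOn ℝ g (Set.Ioi 0) ∧ DifferentiableOn ℝ (deriv g) (Set.Ioi 0) ∧
    ∃ M, ∀ x ∈ Set.Ioi (0 : ℝ), |Dt g x| ≤ M

/-- The space `W²₀(ψ)`: members of `W²(ψ)` with `D̃ g(x) → 0` as `x → 0⁺`. -/
def MemW20 (g : ℝ → ℝ) : Prop :=
  MemW2 g ∧ Filter.Tendsto (Dt g) (nhdsWithin 0 (Set.Ioi 0)) (nhds 0)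

/-- The K-functional `K(f,t)`. -/
noncomputable def Kfun (f : ℝ → ℝ) (t : ℝ) : ℝ :=
  sInf {a : ℝ | ∃ g : ℝ → ℝ, MemW20 g ∧ MemW2 (Dt g) ∧
    a = supNorm (fun x => f x - g x) + t * supNorm (Dt (Dt g))}

/-- The function `T_{n,k}(x)`. -/
noncomputable def T (n : ℕ) (k : ℤ) (x : ℝ) : ℝ :=
  (k : ℝ) * ((k : ℝ) - 1) * (1 + x) / x - 2 * (k : ℝ) * ((n : ℝ) + (k : ℝ))
    + ((n : ℝ) + (k : ℝ)) * ((n : ℝ) + (k : ℝ) + 1) * x / (1 + x)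

lemma P_of_neg {n : ℕ} {k : ℤ} (hk : k < 0) (x : ℝ) : P n k x = 0 := if_pos hk

lemma P_natCast (n k : ℕ) (x : ℝ) :
    P n (k : ℤ) x = (Nat.choose (n + k - 1) k : ℝ) * x ^ k / (1 + x) ^ (n + k) := by
  have h : (-(n : ℤ) - k) = -((n + k : ℕ) : ℤ) := by push_cast; ring
  rw [P, if_neg (by lia), h, zpow_neg, zpow_natCast, Int.toNat_natCast, div_eq_mul_inv]

lemma P_nonneg (n : ℕ) (k : ℤ) {x : ℝ} (hx : 0 ≤ x) : 0 ≤ P n k x := by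
  unfold P
  split_ifs <;> positivity

/-- Index shift `(k+1) P_{n,k+1} = n x P_{n+1,k}`. -/
lemma add_one_mul_P_add_one {n : ℕ} (hn : 1 ≤ n) (k : ℤ) (x : ℝ) :
    ((k : ℝ) + 1) * P n (k + 1) x = n * x * P (n + 1) k x := by
  rcases lt_trichotomy k (-1) with hk | rfl | hk
  · rw [P_of_neg (by lia), P_of_neg (by lia)]; simp
  · rw [P_of_neg (k := -1) (by lia)]; simp
  · lift k to ℕ using by lia
    obtain ⟨m, rfl⟩ : ∃ m, n = m + 1 := ⟨n - 1, by lia⟩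
    rw [show (k : ℤ) + 1 = ((k + 1 : ℕ) : ℤ) by push_cast; ring, P_natCast, P_natCast]
    have h := Nat.add_one_mul_choose_eq (m + k) k
    have e : (m + k).choose k * (m + k + 1) = (m + k + 1).choose k * (m + 1) := by
      rw [Nat.choose_mul_succ_eq, show m + k + 1 - k = m + 1 by lia]
    have h' : ((m + k + 1).choose (k + 1) : ℝ) * (k + 1) = (m + k + 1).choose k * (m + 1) := by
      exact_mod_cast (by rw [← h, ← e, mul_comm] :
        (m + k + 1).choose (k + 1) * (k + 1) = (m + k + 1).choose k * (m + 1))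
    rw [show m + 1 + (k + 1) - 1 = m + k + 1 by lia, show m + 1 + 1 + k - 1 = m + k + 1 by lia,
      show m + 1 + (k + 1) = m + 1 + 1 + k by lia]
    push_cast
    linear_combination (x ^ (k + 1) / (1 + x) ^ (m + 1 + 1 + k)) * h'

/-- Degree shift `n (1+x) P_{n+1,k} = (n+k) P_{n,k}`. -/
lemma one_add_mul_P_succ {n : ℕ} (hn : 1 ≤ n) (k : ℤ) {x : ℝ} (hx : 1 + x ≠ 0) :
    (n : ℝ) * (1 + x) * P (n + 1) k x = ((n : ℝ) + k) * P n k x := by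
  rcases lt_or_ge k 0 with hk | hk
  · simp [P_of_neg hk]
  · lift k to ℕ using hk
    obtain ⟨m, rfl⟩ : ∃ m, n = m + 1 := ⟨n - 1, by lia⟩
    rw [P_natCast, P_natCast]
    have e : (m + k).choose k * (m + k + 1) = (m + k + 1).choose k * (m + 1) := by
      rw [Nat.choose_mul_succ_eq, show m + k + 1 - k = m + 1 by lia]
    have e' : ((m + k).choose k : ℝ) * (m + k + 1) = (m + k + 1).choose k * (m + 1) := by
      exact_mod_cast e
    rw [show m + 1 + 1 + k - 1 = m + k + 1 by lia, show m + 1 + k - 1 = m + k by lia,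
      show m + 1 + 1 + k = m + 1 + k + 1 by lia, pow_succ (1 + x)]
    field_simp
    push_cast
    linear_combination - x ^ k * e'

/-- `ψ P_{n+2,k-1}` is a multiple of `P_{n,k}`. -/
lemma psi_mul_P {n : ℕ} (hn : 1 ≤ n) (k : ℤ) {x : ℝ} (hx : 1 + x ≠ 0) :
    (n : ℝ) * (n + 1) * (psi x * P (n + 2) (k - 1) x) = k * (n + k) * P n k x := by
  have h1 := one_add_mul_P_succ (n := n + 1) (by lia) (k - 1) hx
  have h2 := add_one_mul_P_add_one hn (k - 1) x
  rw [sub_add_cancel] at h2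
  push_cast at h1 h2
  unfold psi
  linear_combination n * x * h1 - (n + k) * h2

/-- Raising the degree: `n P_{n+1,k} = (n+k) P_{n,k} - (k+1) P_{n,k+1}`. -/
lemma mul_P_succ {n : ℕ} (hn : 1 ≤ n) (k : ℤ) {x : ℝ} (hx : 1 + x ≠ 0) :
    (n : ℝ) * P (n + 1) k x = (n + k) * P n k x - (k + 1) * P n (k + 1) x := by
  linear_combination one_add_mul_P_succ hn k hx + add_one_mul_P_add_one hn k x

lemma P_zero_right (n : ℕ) (k : ℤ) : P n k 0 = if k = 0 then 1 else 0 := by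
  rcases lt_or_ge k 0 with hk | hk
  · rw [P_of_neg hk, if_neg hk.ne]
  · lift k to ℕ using hk
    rcases k with _ | k
    · rw [P_natCast]; simp
    · rw [P_natCast, if_neg (by lia)]; simp

lemma hasDerivAt_P {n : ℕ} (hn : 1 ≤ n) (k : ℤ) {x : ℝ} (hx : 0 < x) :
    HasDerivAt (P n k) (n * (P (n + 1) (k - 1) x - P (n + 1) k x)) x := by
  rcases lt_or_ge k 0 with hk | hk
  · rw [P_of_neg hk, P_of_neg (by lia), show P n k = fun _ => 0 from funext (P_of_neg hk)]
    simpa using hasDerivAt_const x (0 : ℝ)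
  · lift k to ℕ using hk
    have hx' : 1 + x ≠ 0 := by positivity
    have key : HasDerivAt (fun y : ℝ => (Nat.choose (n + k - 1) k : ℝ) * y ^ k / (1 + y) ^ (n + k))
        _ x := ((hasDerivAt_pow k x).const_mul ((n + k - 1).choose k : ℝ)).div
          (((hasDerivAt_id x).const_add 1).pow (n + k)) (by positivity)
    rw [show P n (k : ℤ) = _ from funext (P_natCast n k)]
    refine key.congr_deriv ?_
    have h2 := one_add_mul_P_succ hn k hx'
    rw [P_natCast n k] at h2
    obtain ⟨m, rfl⟩ : ∃ m, n = m + 1 := ⟨n - 1, by lia⟩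
    rcases k with _ | k
    · rw [P_of_neg (by lia)]
      rw [show (((m + 1 : ℕ) : ℝ) * (0 - P (m + 1 + 1) ((0 : ℕ) : ℤ) x)) =
        -(((m + 1 : ℕ) : ℝ) * (1 + x) * P (m + 1 + 1) ((0 : ℕ) : ℤ) x) / (1 + x) by field_simp; ring,
        h2]
      simp
      field_simp
      ring
    · have h1 := add_one_mul_P_add_one hn k x
      rw [show (k : ℤ) + 1 = ((k + 1 : ℕ) : ℤ) by push_cast; ring, P_natCast (m + 1) (k + 1)] at h1
      rw [show (((k + 1 : ℕ) : ℤ) - 1) = k by push_cast; ring]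
      rw [mul_sub, show (((m + 1 : ℕ) : ℝ) * P (m + 1 + 1) ((k + 1 : ℕ) : ℤ) x) =
        (((m + 1 : ℕ) : ℝ) * (1 + x) * P (m + 1 + 1) ((k + 1 : ℕ) : ℤ) x) / (1 + x) by field_simp,
        h2]
      have h3 : (((m + 1 : ℕ) : ℝ) * P (m + 1 + 1) (k : ℤ) x) =
        (k + 1) * (((m + 1 + (k + 1) - 1).choose (k + 1) : ℝ) * x ^ k /
          (1 + x) ^ (m + 1 + (k + 1))) := by
        apply mul_left_cancel₀ hx.ne'
        push_cast at h1 ⊢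
        linear_combination -h1
      rw [h3]
      simp
      field_simp
      ring

lemma continuousOn_P (n : ℕ) (k : ℤ) : ContinuousOn (P n k) (Ici 0) := by
  rcases lt_or_ge k 0 with hk | hk
  · rw [show P n k = fun _ => 0 from funext (P_of_neg hk)]
    exact continuousOn_const
  · lift k to ℕ using hk
    rw [show P n (k : ℤ) = _ from funext (P_natCast n k)]
    refine ContinuousOn.div (by fun_prop) (by fun_prop) fun x (hx : 0 ≤ x) => ?_
    positivity

lemma exists_P_le (n : ℕ) (k : ℤ) : ∃ C : ℝ, 0 ≤ C ∧ ∀ x : ℝ, 0 ≤ x → P n k x ≤ C * P n 0 x := by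
  rcases lt_or_ge k 0 with hk | hk
  · exact ⟨0, le_rfl, fun x _ => by simp [P_of_neg hk]⟩
  · lift k to ℕ using hk
    refine ⟨(n + k - 1).choose k, by positivity, fun x hx => ?_⟩
    rw [P_natCast, show (0 : ℤ) = ((0 : ℕ) : ℤ) from rfl, P_natCast, mul_div_assoc, pow_add]
    refine mul_le_mul_of_nonneg_left ?_ (by positivity)
    simp only [Nat.choose_zero_right, pow_zero, Nat.cast_one, mul_one, add_zero]
    rw [div_le_div_iff₀ (by positivity) (by positivity)]
    have := pow_le_pow_left₀ hx (by linarith : x ≤ 1 + x) k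
    have h0 : (0 : ℝ) ≤ (1 + x) ^ n := by positivity
    nlinarith

lemma tendsto_P_atTop {n : ℕ} (hn : 1 ≤ n) (k : ℤ) : Tendsto (P n k) atTop (nhds 0) := by
  obtain ⟨C, -, hC⟩ := exists_P_le n k
  have h0 : Tendsto (fun x : ℝ => C * P n 0 x) atTop (nhds 0) := by
    have : Tendsto (fun x : ℝ => ((1 + x) ^ n)⁻¹) atTop (nhds 0) :=
      ((tendsto_pow_atTop (by lia)).comp
        (tendsto_atTop_add_const_left _ 1 tendsto_id)).inv_tendsto_atTop
    have h := this.const_mul C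
    rw [mul_zero] at h
    refine h.congr fun x => ?_
    rw [show (0 : ℤ) = ((0 : ℕ) : ℤ) from rfl, P_natCast]
    simp
  refine squeeze_zero' ?_ ?_ h0
  · filter_upwards [eventually_ge_atTop 0] with x hx using P_nonneg n k hx
  · filter_upwards [eventually_ge_atTop 0] with x hx using hC x hx

lemma integrableOn_P {n : ℕ} (hn : 2 ≤ n) (k : ℤ) : IntegrableOn (P n k) (Ioi 0) := by
  obtain ⟨m, rfl⟩ : ∃ m, n = m + 1 := ⟨n - 1, by lia⟩
  have hm : 1 ≤ m := by lia
  have h0 : IntegrableOn (P (m + 1) 0) (Ioi 0) := by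
    have hd : ∀ x ∈ Ioi (0 : ℝ), HasDerivAt (fun y => - ((m : ℝ)⁻¹ * P m 0 y)) (P (m + 1) 0 x) x := by
      intro x hx
      refine ((hasDerivAt_P hm 0 hx).const_mul _).neg.congr_deriv ?_
      rw [P_of_neg (k := 0 - 1) (by lia)]
      field_simp
      ring
    refine integrableOn_Ioi_deriv_of_nonneg (l := - ((m : ℝ)⁻¹ * 0)) ?_ hd
      (fun x hx => P_nonneg _ _ (le_of_lt hx)) ((tendsto_P_atTop hm 0).const_mul _).neg
    exact (((continuousOn_P m 0) 0 self_mem_Ici).const_mul _).neg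
  obtain ⟨C, hC0, hC⟩ := exists_P_le (m + 1) k
  refine Integrable.mono' (h0.const_mul C)
    (((continuousOn_P _ _).mono Ioi_subset_Ici_self).aestronglyMeasurable measurableSet_Ioi) ?_
  filter_upwards [ae_restrict_mem measurableSet_Ioi] with x hx
  rw [Real.norm_of_nonneg (P_nonneg _ _ (le_of_lt hx))]
  exact hC x (le_of_lt hx)

lemma integral_P {n : ℕ} (hn : 1 ≤ n) (k : ℕ) :
    ∫ t in Ioi (0 : ℝ), P (n + 1) (k : ℤ) t = 1 / n := by
  have hn0 : (n : ℝ) ≠ 0 := by positivity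
  have step (j : ℤ) : (n : ℝ) * ((∫ t in Ioi (0 : ℝ), P (n + 1) (j - 1) t) -
      ∫ t in Ioi (0 : ℝ), P (n + 1) j t) = - P n j 0 := by
    rw [← integral_sub (integrableOn_P (by lia) _) (integrableOn_P (by lia) _),
      ← integral_const_mul, ← zero_sub]
    exact integral_Ioi_of_hasDerivAt_of_tendsto ((continuousOn_P n j) 0 self_mem_Ici)
      (fun x hx => hasDerivAt_P hn j hx)
      (((integrableOn_P (by lia) _).sub (integrableOn_P (by lia) _)).const_mul _)
      (tendsto_P_atTop hn j)
  induction k with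
  | zero =>
    have h := step 0
    rw [P_zero_right, if_pos rfl] at h
    simp only [P_of_neg (show (0 : ℤ) - 1 < 0 by lia), integral_zero] at h
    push_cast
    field_simp
    linarith
  | succ k ih =>
    have h := step (k + 1)
    rw [P_zero_right, if_neg (by lia), add_sub_cancel_right, ih] at h
    push_cast
    have := (mul_eq_zero.1 (h.trans neg_zero)).resolve_left hn0
    linarith

lemma hasSum_P {n : ℕ} (hn : 1 ≤ n) {x : ℝ} (hx : 0 ≤ x) :
    HasSum (fun k : ℕ => P n (k : ℤ) x) 1 := by
  obtain ⟨m, rfl⟩ : ∃ m, n = m + 1 := ⟨n - 1, by lia⟩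
  have hr : ‖x / (1 + x)‖ < 1 := by
    rw [Real.norm_of_nonneg (by positivity), div_lt_one (by positivity)]
    linarith
  have h := (hasSum_choose_mul_geometric_of_norm_lt_one m hr).mul_right (1 / (1 + x) ^ (m + 1))
  have e : 1 - x / (1 + x) = 1 / (1 + x) := by field_simp; ring
  have e1 : 1 / (1 - x / (1 + x)) ^ (m + 1) * (1 / (1 + x) ^ (m + 1)) = 1 := by
    rw [e, one_div_pow]
    field_simp
  rw [e1] at h
  refine h.congr_fun fun k => ?_
  rw [P_natCast, show m + 1 + k - 1 = k + m by lia, Nat.choose_symm_add, div_pow]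
  field_simp
  ring

lemma hasSum_mul_P {n : ℕ} (hn : 1 ≤ n) {x : ℝ} (hx : 0 ≤ x) :
    HasSum (fun k : ℕ => (k : ℝ) * P n (k : ℤ) x) (n * x) := by
  rw [← hasSum_nat_add_iff' 1]
  have h := (hasSum_P (n := n + 1) (by lia) hx).mul_left (n * x)
  simp only [Finset.range_one, Finset.sum_singleton, Nat.cast_zero, zero_mul, sub_zero]
  rw [mul_one] at h
  refine h.congr_fun fun k => ?_
  have := add_one_mul_P_add_one hn k x
  push_cast
  exact_mod_cast this

lemma hasSum_sq_mul_P {n : ℕ} (hn : 1 ≤ n) {x : ℝ} (hx : 0 ≤ x) :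
    HasSum (fun k : ℕ => (k : ℝ) ^ 2 * P n (k : ℤ) x) (n * x * ((n + 1) * x + 1)) := by
  rw [← hasSum_nat_add_iff' 1]
  have h := ((hasSum_mul_P (n := n + 1) (by lia) hx).add
    (hasSum_P (n := n + 1) (by lia) hx)).mul_left (n * x)
  simp only [Finset.range_one, Finset.sum_singleton, Nat.cast_zero, ne_eq, OfNat.ofNat_ne_zero,
    not_false_eq_true, zero_pow, zero_mul, sub_zero]
  push_cast at h
  refine h.congr_fun fun k => ?_
  have := add_one_mul_P_add_one hn k x
  push_cast at this ⊢
  linear_combination ((k : ℝ) + 1) * this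

lemma v_zero (n : ℕ) (g : ℝ → ℝ) : v n 0 g = g 0 := if_pos rfl

lemma v_succ (n j : ℕ) (g : ℝ → ℝ) :
    v n (j + 1) g = (n + 1) * ∫ t in Ioi (0 : ℝ), P (n + 2) (j : ℤ) t * g t := by
  rw [v, if_neg (by lia)]
  simp

lemma integrableOn_P_mul {n : ℕ} (hn : 2 ≤ n) (k : ℤ) {g : ℝ → ℝ} {B : ℝ}
    (hg : AEStronglyMeasurable g (volume.restrict (Ioi 0))) (hB : ∀ t ∈ Ioi (0 : ℝ), |g t| ≤ B) :
    IntegrableOn (fun t => P n k t * g t) (Ioi 0) := by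
  refine (integrableOn_P hn k).mul_bdd (c := B) hg ?_
  filter_upwards [ae_restrict_mem measurableSet_Ioi] with t ht using hB t ht

lemma abs_v_le (n k : ℕ) {g : ℝ → ℝ} {B : ℝ} (hB : ∀ t ∈ Ici (0 : ℝ), |g t| ≤ B) :
    |v n k g| ≤ B := by
  rcases k with _ | j
  · rw [v_zero]
    exact hB 0 self_mem_Ici
  · have h := norm_integral_le_of_norm_le (μ := volume.restrict (Ioi 0))
      (f := fun t => P (n + 2) (j : ℤ) t * g t)
      ((integrableOn_P (n := n + 2) (by lia) j).mul_const B) (by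
        filter_upwards [ae_restrict_mem measurableSet_Ioi] with t ht
        have ht' : (0 : ℝ) ≤ t := le_of_lt ht
        rw [norm_mul, Real.norm_of_nonneg (P_nonneg _ _ ht')]
        exact mul_le_mul_of_nonneg_left (hB t ht') (P_nonneg _ _ ht'))
    rw [integral_mul_const, integral_P (by lia), Real.norm_eq_abs] at h
    rw [v_succ, abs_mul, abs_of_nonneg (by positivity : (0 : ℝ) ≤ n + 1)]
    calc _ ≤ ((n : ℝ) + 1) * (1 / ((n + 1 : ℕ) : ℝ) * B) := by gcongr
      _ = B := by push_cast; field_simp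

/-- The second moment of `v_{n,k}` about `x`. -/
noncomputable def secondMoment (n k : ℕ) (x : ℝ) : ℝ :=
  k * (k + 1) / (n * (n - 1)) - 2 * x * k / n + x ^ 2

lemma integral_P_mul_sq_sub {n : ℕ} (hn : 2 ≤ n) (j : ℕ) (x : ℝ) :
    IntegrableOn (fun t => P (n + 2) (j : ℤ) t * (t - x) ^ 2) (Ioi 0) ∧
    ((n : ℝ) + 1) * ∫ t in Ioi (0 : ℝ), P (n + 2) (j : ℤ) t * (t - x) ^ 2
      = secondMoment n (j + 1) x := by
  have hn0 : (n : ℝ) ≠ 0 := by positivity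
  have hn1 : (n : ℝ) - 1 ≠ 0 := by
    have : (2 : ℝ) ≤ n := by exact_mod_cast hn
    linarith
  have e : (fun t => P (n + 2) (j : ℤ) t * (t - x) ^ 2) = fun t =>
      ((j + 1) * (j + 2) / ((n + 1) * n)) * P n ((j + 2 : ℕ) : ℤ) t
        - (2 * x * (j + 1) / (n + 1)) * P (n + 1) ((j + 1 : ℕ) : ℤ) t
        + x ^ 2 * P (n + 2) (j : ℤ) t := by
    funext t
    have h1 := add_one_mul_P_add_one (n := n + 1) (by lia) j t
    have h2 := add_one_mul_P_add_one (n := n) (by lia) (j + 1) t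
    push_cast at h1 h2 ⊢
    rw [show (j : ℤ) + 1 + 1 = j + 2 by ring] at h2
    field_simp
    linear_combination (2 * x - t) * n * h1 - (j + 1) * h2
  have i0 : IntegrableOn (fun t => ((j + 1) * (j + 2) / ((n + 1) * n)) *
      P n ((j + 2 : ℕ) : ℤ) t) (Ioi 0) := (integrableOn_P hn _).const_mul _
  have i1 : IntegrableOn (fun t => (2 * x * (j + 1) / (n + 1)) *
      P (n + 1) ((j + 1 : ℕ) : ℤ) t) (Ioi 0) := (integrableOn_P (by lia) _).const_mul _
  have i2 : IntegrableOn (fun t => x ^ 2 * P (n + 2) (j : ℤ) t) (Ioi 0) :=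
    (integrableOn_P (by lia) _).const_mul _
  have i01 : IntegrableOn (fun t => ((j + 1) * (j + 2) / ((n + 1) * n)) * P n ((j + 2 : ℕ) : ℤ) t
      - (2 * x * (j + 1) / (n + 1)) * P (n + 1) ((j + 1 : ℕ) : ℤ) t) (Ioi 0) := i0.sub i1
  rw [e]
  refine ⟨i01.add i2, ?_⟩
  rw [integral_add i01 i2, integral_sub i0 i1, integral_const_mul, integral_const_mul,
    integral_const_mul, integral_P (by lia), integral_P (by lia)]
  obtain ⟨m, rfl⟩ : ∃ m, n = m + 1 := ⟨n - 1, by lia⟩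
  rw [integral_P (by lia), secondMoment]
  push_cast at hn0 hn1 ⊢
  simp only [add_sub_cancel_right] at hn1 ⊢
  field_simp
  ring

lemma hasSum_secondMoment_mul_P {n : ℕ} (hn : 2 ≤ n) {x : ℝ} (hx : 0 ≤ x) :
    HasSum (fun k : ℕ => secondMoment n k x * P n (k : ℤ) x) (2 * x * (1 + x) / (n - 1)) := by
  have hn0 : (n : ℝ) ≠ 0 := by positivity
  have hn1 : (n : ℝ) - 1 ≠ 0 := by
    have : (2 : ℝ) ≤ n := by exact_mod_cast hn
    linarith
  have h2 := (hasSum_sq_mul_P (by lia : 1 ≤ n) hx).mul_left (1 / ((n : ℝ) * (n - 1)))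
  have h1 := (hasSum_mul_P (by lia : 1 ≤ n) hx).mul_left (1 / ((n : ℝ) * (n - 1)) - 2 * x / n)
  have h0 := (hasSum_P (by lia : 1 ≤ n) hx).mul_left (x ^ 2)
  have h := (h2.add h1).add h0
  convert! h using 1
  · funext k
    rw [secondMoment]
    ring
  · field_simp
    ring

lemma exists_abs_sub_le_add_mul_sq {g : ℝ → ℝ} (hg : BddContOn g) {x : ℝ} (hx : 0 ≤ x) {ε : ℝ}
    (hε : 0 < ε) : ∃ C, 0 ≤ C ∧ ∀ t, 0 ≤ t → |g t - g x| ≤ ε + C * (t - x) ^ 2 := by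
  obtain ⟨hc, B, hB⟩ := hg
  obtain ⟨δ, hδ, h⟩ := Metric.continuousWithinAt_iff.1 (hc x hx) ε hε
  have hB0 : 0 ≤ B := (abs_nonneg _).trans (hB x hx)
  refine ⟨2 * B / δ ^ 2, by positivity, fun t ht => ?_⟩
  rcases lt_or_ge |t - x| δ with hd | hd
  · have := h ht (by rwa [Real.dist_eq])
    rw [Real.dist_eq] at this
    have : 0 ≤ 2 * B / δ ^ 2 * (t - x) ^ 2 := by positivity
    linarith
  · have h1 : |g t - g x| ≤ 2 * B := by
      have := abs_sub (g t) (g x)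
      have := hB t ht
      have := hB x hx
      linarith
    have h2 : δ ^ 2 ≤ (t - x) ^ 2 := by
      rw [← sq_abs (t - x)]
      gcongr
    have : 2 * B ≤ 2 * B / δ ^ 2 * (t - x) ^ 2 := by
      rw [div_mul_eq_mul_div, le_div_iff₀ (by positivity)]
      gcongr
    linarith

lemma abs_v_sub_le {n : ℕ} (hn : 2 ≤ n) (k : ℕ) {g : ℝ → ℝ} (hg : BddContOn g) {y x ε C : ℝ}
    (h : ∀ t, 0 ≤ t → |g t - y| ≤ ε + C * (t - x) ^ 2) :
    |v n k g - y| ≤ ε + C * secondMoment n k x := by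
  rcases k with _ | j
  · have := h 0 le_rfl
    rw [v_zero, secondMoment]
    simpa using this
  · obtain ⟨hc, B, hB⟩ := hg
    obtain ⟨hi, he⟩ := integral_P_mul_sq_sub hn j x
    have ip := integrableOn_P (n := n + 2) (by lia) (j : ℤ)
    have ig : IntegrableOn (fun t => P (n + 2) (j : ℤ) t * g t) (Ioi 0) :=
      integrableOn_P_mul (by lia) _
        ((hc.mono Ioi_subset_Ici_self).aestronglyMeasurable measurableSet_Ioi)
        fun t ht => hB t (Ioi_subset_Ici_self ht)
    have hle := norm_integral_le_of_norm_le (μ := volume.restrict (Ioi 0))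
      (f := fun t => P (n + 2) (j : ℤ) t * g t - P (n + 2) (j : ℤ) t * y)
      (g := fun t => P (n + 2) (j : ℤ) t * ε + C * (P (n + 2) (j : ℤ) t * (t - x) ^ 2))
      ((ip.mul_const ε).add (hi.const_mul C)) (by
        filter_upwards [ae_restrict_mem measurableSet_Ioi] with t ht
        have ht' : (0 : ℝ) ≤ t := le_of_lt ht
        have h0 := P_nonneg (n + 2) j ht'
        rw [← mul_sub, norm_mul, Real.norm_of_nonneg h0, Real.norm_eq_abs]
        have := mul_le_mul_of_nonneg_left (h t ht') h0
        linarith)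
    rw [integral_sub ig (ip.mul_const y), integral_add (ip.mul_const ε) (hi.const_mul C),
      integral_mul_const, integral_mul_const, integral_const_mul, integral_P (by lia),
      Real.norm_eq_abs] at hle
    have hpos : (0 : ℝ) < n + 1 := by positivity
    push_cast at hle
    rw [← he, v_succ]
    set I := ∫ t in Ioi (0 : ℝ), P (n + 2) (j : ℤ) t * g t
    set J := ∫ t in Ioi (0 : ℝ), P (n + 2) (j : ℤ) t * (t - x) ^ 2
    calc |((n : ℝ) + 1) * I - y| = |((n : ℝ) + 1) * (I - 1 / (n + 1) * y)| := by
          congr 1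
          field_simp
      _ = ((n : ℝ) + 1) * |I - 1 / (n + 1) * y| := by rw [abs_mul, abs_of_pos hpos]
      _ ≤ ((n : ℝ) + 1) * (1 / (n + 1) * ε + C * J) := mul_le_mul_of_nonneg_left hle hpos.le
      _ = ε + C * (((n : ℝ) + 1) * J) := by
          field_simp

lemma summable_mul_P {n : ℕ} (hn : 1 ≤ n) {x : ℝ} (hx : 0 ≤ x) {a : ℕ → ℝ} {B : ℝ}
    (ha : ∀ k, |a k| ≤ B) : Summable fun k : ℕ => a k * P n (k : ℤ) x := by
  refine Summable.of_norm_bounded ((hasSum_P hn hx).summable.mul_left B) fun k => ?_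
  rw [norm_mul, Real.norm_of_nonneg (P_nonneg n k hx)]
  exact mul_le_mul_of_nonneg_right (ha k) (P_nonneg n k hx)

lemma abs_V_le {n : ℕ} (hn : 1 ≤ n) {x : ℝ} (hx : 0 ≤ x) {g : ℝ → ℝ} {B : ℝ}
    (hB : ∀ t ∈ Ici (0 : ℝ), |g t| ≤ B) : |V n g x| ≤ B := by
  have h := tsum_of_norm_bounded (f := fun k : ℕ => v n k g * P n (k : ℤ) x)
    ((hasSum_P hn hx).mul_left B) fun k => by
      rw [norm_mul, Real.norm_of_nonneg (P_nonneg n k hx)]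
      exact mul_le_mul_of_nonneg_right (abs_v_le n k hB) (P_nonneg n k hx)
  rwa [mul_one] at h

lemma abs_V_sub_le {n : ℕ} (hn : 2 ≤ n) {x : ℝ} (hx : 0 ≤ x) {g : ℝ → ℝ} (hg : BddContOn g)
    {ε C : ℝ} (h : ∀ t, 0 ≤ t → |g t - g x| ≤ ε + C * (t - x) ^ 2) :
    |V n g x - g x| ≤ ε + C * (2 * x * (1 + x) / (n - 1)) := by
  obtain ⟨B, hB⟩ := hg.2
  have hs := summable_mul_P (by lia : 1 ≤ n) hx (abs_v_le n · hB)
  have hp := hasSum_P (by lia : 1 ≤ n) hx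
  have e : V n g x - g x = ∑' k : ℕ, (v n k g - g x) * P n (k : ℤ) x := by
    simp only [sub_mul]
    rw [hs.tsum_sub (hp.summable.mul_left _), tsum_mul_left, hp.tsum_eq, mul_one, V]
  rw [e, ← Real.norm_eq_abs]
  have hb := (hp.mul_left ε).add ((hasSum_secondMoment_mul_P hn hx).mul_left C)
  rw [mul_one] at hb
  refine tsum_of_norm_bounded hb fun k => ?_
  have h0 := P_nonneg n k hx
  rw [norm_mul, Real.norm_of_nonneg h0, Real.norm_eq_abs]
  have := mul_le_mul_of_nonneg_right (abs_v_sub_le hn k hg h) h0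
  linarith

lemma tendsto_V {g : ℝ → ℝ} (hg : BddContOn g) {x : ℝ} (hx : 0 ≤ x) :
    Tendsto (fun n => V n g x) atTop (nhds (g x)) := by
  rw [Metric.tendsto_nhds]
  intro ε hε
  obtain ⟨C, -, h⟩ := exists_abs_sub_le_add_mul_sq hg hx (half_pos hε)
  have ht : Tendsto (fun n : ℕ => C * (2 * x * (1 + x) / ((n : ℝ) - 1))) atTop (nhds 0) := by
    have : Tendsto (fun n : ℕ => (n : ℝ) - 1) atTop atTop :=
      tendsto_atTop_add_const_right _ _ tendsto_natCast_atTop_atTop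
    simpa using (this.const_div_atTop (2 * x * (1 + x))).const_mul C
  filter_upwards [ht.eventually_lt_const (half_pos hε), eventually_ge_atTop 2] with n h1 h2
  have := abs_V_sub_le h2 hx hg h
  rw [Real.dist_eq]
  linarith

lemma integral_Ioi_of_hasDerivAt_of_tendsto_nhdsGT {F F' : ℝ → ℝ} {a l m : ℝ}
    (hF : ∀ x ∈ Ioi a, HasDerivAt F (F' x) x) (hi : IntegrableOn F' (Ioi a))
    (ha : Tendsto F (nhdsWithin a (Ioi a)) (nhds l)) (hm : Tendsto F atTop (nhds m)) :
    ∫ x in Ioi a, F' x = m - l := by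
  have h := integral_Ioi_deriv_mul_eq_sub (u := F) (u' := F') (v := fun _ => 1) (v' := fun _ => 0)
    (a := a) (a' := l) (b' := m) hF (fun x _ => hasDerivAt_const x 1)
  simp only [mul_one, mul_zero, add_zero] at h
  refine h ?_ ?_ ?_
  · exact hi.congr_fun (fun x _ => by simp) measurableSet_Ioi
  · exact ha.congr fun x => by simp
  · exact hm.congr fun x => by simp

lemma Dt_zero (g : ℝ → ℝ) : Dt g 0 = 0 := by simp [Dt, psi]

lemma hasDerivAt_of_memW2 {g : ℝ → ℝ} (hg : MemW2 g) {t : ℝ} (ht : 0 < t) :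
    HasDerivAt g (deriv g t) t :=
  (hg.1.differentiableAt (Ioi_mem_nhds ht)).hasDerivAt

lemma hasDerivAt_deriv_of_memW2 {g : ℝ → ℝ} (hg : MemW2 g) {t : ℝ} (ht : 0 < t) :
    HasDerivAt (deriv g) (deriv (deriv g) t) t :=
  (hg.2.1.differentiableAt (Ioi_mem_nhds ht)).hasDerivAt

lemma exists_abs_mul_deriv_le {g : ℝ → ℝ} (hg : MemW2 g) :
    ∃ M, ∀ t, 0 < t → |t * deriv g t| ≤ |g (2 * t) - g t| + M * (t / (1 + t)) := by
  obtain ⟨M, hM⟩ := hg.2.2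
  refine ⟨M, fun t ht => ?_⟩
  have hM0 : 0 ≤ M := (abs_nonneg _).trans (hM t ht)
  obtain ⟨ξ, ⟨h1, h2⟩, hξ⟩ := exists_deriv_eq_slope g (by linarith : t < 2 * t)
    (fun s hs => (hasDerivAt_of_memW2 hg (ht.trans_le hs.1)).continuousAt.continuousWithinAt)
    (fun s hs => (hasDerivAt_of_memW2 hg (ht.trans hs.1)).differentiableAt.differentiableWithinAt)
  have hξ' : t * deriv g ξ = g (2 * t) - g t := by
    rw [hξ]
    field_simp
    ring
  have hb : ∀ s ∈ Icc t ξ, ‖deriv (deriv g) s‖ ≤ M / (t * (1 + t)) := by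
    intro s hs
    have hs0 : 0 < s := ht.trans_le hs.1
    have := hM s hs0
    rw [Dt, psi, abs_mul, abs_of_pos (by positivity)] at this
    rw [Real.norm_eq_abs]
    calc _ ≤ M / (s * (1 + s)) := by rw [le_div_iff₀ (by positivity)]; linarith
      _ ≤ _ := by
        have := hs.1
        gcongr
  have hd : ‖deriv g ξ - deriv g t‖ ≤ M / (t * (1 + t)) * ‖ξ - t‖ :=
    (convex_Icc t ξ).norm_image_sub_le_of_norm_hasDerivWithin_le
      (fun s hs => (hasDerivAt_deriv_of_memW2 hg (ht.trans_le hs.1)).hasDerivWithinAt) hb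
      (left_mem_Icc.2 h1.le) (right_mem_Icc.2 h1.le)
  rw [Real.norm_eq_abs, Real.norm_eq_abs, abs_of_pos (sub_pos.2 h1)] at hd
  have hd' : |t * (deriv g ξ - deriv g t)| ≤ M * (t / (1 + t)) := by
    rw [abs_mul, abs_of_pos ht]
    calc _ ≤ t * (M / (t * (1 + t)) * t) := by
          refine mul_le_mul_of_nonneg_left (hd.trans ?_) ht.le
          refine mul_le_mul_of_nonneg_left (by linarith) (by positivity)
      _ = _ := by field_simp
  calc |t * deriv g t| = |(g (2 * t) - g t) - t * (deriv g ξ - deriv g t)| := by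
        rw [← hξ']; congr 1; ring
    _ ≤ _ := (abs_sub _ _).trans (by linarith)

lemma tendsto_mul_deriv_nhdsGT_zero {g : ℝ → ℝ} (hb : BddContOn g) (hg : MemW2 g) :
    Tendsto (fun t => t * deriv g t) (nhdsWithin 0 (Ioi 0)) (nhds 0) := by
  obtain ⟨M, hM⟩ := exists_abs_mul_deriv_le hg
  have hc : Tendsto g (nhdsWithin 0 (Ioi 0)) (nhds (g 0)) :=
    (hb.1 0 self_mem_Ici).mono_left (nhdsWithin_mono _ Ioi_subset_Ici_self)
  have h2 : Tendsto (fun t : ℝ => 2 * t) (nhdsWithin 0 (Ioi 0)) (nhdsWithin 0 (Ioi 0)) := by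
    refine tendsto_nhdsWithin_iff.2 ⟨?_, ?_⟩
    · have : Tendsto (fun t : ℝ => 2 * t) (nhds 0) (nhds (2 * 0)) :=
        (continuous_const.mul continuous_id).tendsto 0
      rw [mul_zero] at this
      exact this.mono_left nhdsWithin_le_nhds
    · filter_upwards [self_mem_nhdsWithin] with t (ht : 0 < t)
      exact mul_pos two_pos ht
  have h3 : Tendsto (fun t : ℝ => t / (1 + t)) (nhdsWithin 0 (Ioi 0)) (nhds (0 / (1 + 0))) := by
    refine Tendsto.mono_left ?_ nhdsWithin_le_nhds
    have : ContinuousAt (fun t : ℝ => t / (1 + t)) 0 :=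
      ContinuousAt.div (by fun_prop) (by fun_prop) (by norm_num)
    exact this
  refine squeeze_zero_norm' (a := fun t => |g (2 * t) - g t| + M * (t / (1 + t))) ?_ ?_
  · filter_upwards [self_mem_nhdsWithin] with t ht using hM t ht
  · simpa using ((hc.comp h2).sub hc).abs.add (h3.const_mul M)

lemma exists_abs_mul_deriv_le_const {g : ℝ → ℝ} (hb : BddContOn g) (hg : MemW2 g) :
    ∃ K, ∀ t, 0 < t → |t * deriv g t| ≤ K := by
  obtain ⟨M, hM⟩ := exists_abs_mul_deriv_le hg
  obtain ⟨B, hB⟩ := hb.2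
  refine ⟨2 * B + |M|, fun t ht => (hM t ht).trans ?_⟩
  have h1 := abs_sub (g (2 * t)) (g t)
  have h2 := hB t ht.le
  have h3 := hB (2 * t) (by simp [ht.le])
  have h4 : t / (1 + t) ≤ 1 := (div_le_one (by positivity)).2 (by linarith)
  have h5 : M * (t / (1 + t)) ≤ |M| * 1 := by
    have := le_abs_self M
    gcongr
  linarith

/-- Integration by parts against the Baskakov kernel. -/
lemma v_Dt {n : ℕ} (hn : 1 ≤ n) (j : ℕ) {g : ℝ → ℝ} (hb : BddContOn g) (hg : MemW2 g) :
    v n (j + 1) (Dt g) =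
      ((j : ℝ) + 1) * (n + (j + 1)) * (v n (j + 2) g - 2 * v n (j + 1) g + v n j g) := by
  obtain ⟨K, hK⟩ := exists_abs_mul_deriv_le_const hb hg
  obtain ⟨B, hB⟩ := hb.2
  obtain ⟨M, hM⟩ := hg.2.2
  have hn0 : (n : ℝ) ≠ 0 := by positivity
  have hgm : AEStronglyMeasurable g (volume.restrict (Ioi 0)) :=
    (hb.1.mono Ioi_subset_Ici_self).aestronglyMeasurable measurableSet_Ioi
  have hDm : AEStronglyMeasurable (Dt g) (volume.restrict (Ioi 0)) := by
    refine Measurable.aestronglyMeasurable ?_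
    unfold Dt psi
    exact (by fun_prop : Measurable fun x : ℝ => x * (1 + x)).mul (measurable_deriv _)
  have ig (k : ℤ) : IntegrableOn (fun t => P (n + 2) k t * g t) (Ioi 0) :=
    integrableOn_P_mul (by lia) k hgm fun t ht => hB t (Ioi_subset_Ici_self ht)
  have iD (k : ℤ) : IntegrableOn (fun t => P (n + 2) k t * Dt g t) (Ioi 0) :=
    integrableOn_P_mul (by lia) k hDm hM
  set c : ℝ := (j + 1) * (n + (j + 1)) with hc
  set F : ℝ → ℝ := fun t => c * (P n (j + 1) t * deriv g t
    - n * (P (n + 1) j t - P (n + 1) (j + 1) t) * g t) with hF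
  set F' : ℝ → ℝ := fun t => n * (n + 1) * (P (n + 2) j t * Dt g t - c * (P (n + 2) (j - 1) t * g t
    - 2 * (P (n + 2) j t * g t) + P (n + 2) (j + 1) t * g t)) with hF'
  have hd : ∀ t ∈ Ioi (0 : ℝ), HasDerivAt F (F' t) t := by
    intro t (ht : 0 < t)
    have d0 := hasDerivAt_P hn (j + 1) ht
    have d1 := hasDerivAt_P (n := n + 1) (by lia) j ht
    have d2 := hasDerivAt_P (n := n + 1) (by lia) (j + 1) ht
    have dg := hasDerivAt_of_memW2 hg ht
    have dg' := hasDerivAt_deriv_of_memW2 hg ht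
    refine (((d0.mul dg').sub (((d1.sub d2).const_mul (n : ℝ)).mul dg)).const_mul c).congr_deriv ?_
    have h := psi_mul_P hn (j + 1) (by positivity : 1 + t ≠ 0)
    simp only [add_sub_cancel_right, hF', Dt, Pi.sub_apply] at h ⊢
    push_cast at h ⊢
    linear_combination -deriv (deriv g) t * h
  have i2 : IntegrableOn (fun t => 2 * (P (n + 2) j t * g t)) (Ioi 0) := (ig j).const_mul 2
  have i12 : IntegrableOn (fun t => P (n + 2) (j - 1) t * g t - 2 * (P (n + 2) j t * g t))
      (Ioi 0) := (ig (j - 1)).sub i2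
  have i123 : IntegrableOn (fun t => c * (P (n + 2) (j - 1) t * g t - 2 * (P (n + 2) j t * g t)
      + P (n + 2) (j + 1) t * g t)) (Ioi 0) := (i12.add (ig (j + 1))).const_mul c
  have hi : IntegrableOn F' (Ioi 0) := ((iD j).sub i123).const_mul _
  have hmul (t : ℝ) : ((j : ℝ) + 1) * (P n (j + 1) t * deriv g t) =
      n * (P (n + 1) j t * (t * deriv g t)) := by
    linear_combination (deriv g t) * add_one_mul_P_add_one hn j t
  have hFeq : F = fun t => (n + (j + 1)) * (n * (P (n + 1) j t * (t * deriv g t)))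
      - c * (n * (P (n + 1) j t - P (n + 1) (j + 1) t) * g t) := by
    funext t
    rw [← hmul, hF, hc]
    ring
  have lim0 (k : ℤ) : Tendsto (P (n + 1) k) (nhdsWithin 0 (Ioi 0)) (nhds (P (n + 1) k 0)) :=
    (continuousOn_P (n + 1) k 0 self_mem_Ici).mono_left (nhdsWithin_mono _ Ioi_subset_Ici_self)
  have hg0 : Tendsto g (nhdsWithin 0 (Ioi 0)) (nhds (g 0)) :=
    (hb.1 0 self_mem_Ici).mono_left (nhdsWithin_mono _ Ioi_subset_Ici_self)
  have hz : Tendsto F (nhdsWithin 0 (Ioi 0)) (nhds (- (c * (n * P (n + 1) j 0 * g 0)))) := by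
    rw [hFeq]
    have := ((((lim0 j).mul (tendsto_mul_deriv_nhdsGT_zero hb hg)).const_mul (n : ℝ)).const_mul
      ((n : ℝ) + (j + 1))).sub (((((lim0 j).sub (lim0 (j + 1))).const_mul (n : ℝ)).mul hg0).const_mul
      c)
    rw [P_zero_right (n + 1) (j + 1), if_neg (by lia)] at this
    simpa using this
  have bddmul {u : ℝ → ℝ} {D : ℝ} (k : ℤ) (hu : ∀ t, 0 < t → |u t| ≤ D) :
      Tendsto (fun t => P (n + 1) k t * u t) atTop (nhds 0) := by
    have := ((tendsto_P_atTop (n := n + 1) (by lia) k).mul_const D)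
    rw [zero_mul] at this
    refine squeeze_zero_norm' ?_ this
    filter_upwards [eventually_gt_atTop 0] with t ht
    have h0 := P_nonneg (n + 1) k ht.le
    rw [norm_mul, Real.norm_of_nonneg h0]
    exact mul_le_mul_of_nonneg_left (hu t ht) h0
  have hinf : Tendsto F atTop (nhds 0) := by
    rw [hFeq]
    have hgb : ∀ t, 0 < t → |g t| ≤ B := fun t ht => hB t (Ioi_subset_Ici_self ht)
    have := (((bddmul j hK).const_mul (n : ℝ)).const_mul ((n : ℝ) + (j + 1))).sub
      ((((bddmul j hgb).sub (bddmul (j + 1) hgb)).const_mul (n : ℝ)).const_mul c)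
    simp only [mul_zero, sub_zero] at this
    refine this.congr fun t => ?_
    ring
  have key := integral_Ioi_of_hasDerivAt_of_tendsto_nhdsGT hd hi hz hinf
  have hint : ∫ t in Ioi (0 : ℝ), F' t = n * (n + 1) * ((∫ t in Ioi (0 : ℝ), P (n + 2) j t * Dt g t)
      - c * ((∫ t in Ioi (0 : ℝ), P (n + 2) (j - 1) t * g t)
        - 2 * (∫ t in Ioi (0 : ℝ), P (n + 2) j t * g t)
        + ∫ t in Ioi (0 : ℝ), P (n + 2) (j + 1) t * g t)) := by
    rw [hF', integral_const_mul, integral_sub (iD j) i123, integral_const_mul,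
      integral_add i12 (ig (j + 1)), integral_sub (ig (j - 1)) i2, integral_const_mul]
  rw [hint] at key
  have hv0 : v n j g = g 0 * P (n + 1) j 0
      + (n + 1) * ∫ t in Ioi (0 : ℝ), P (n + 2) (j - 1) t * g t := by
    rw [P_zero_right]
    rcases j with _ | i
    · simp [v_zero, P_of_neg (show (-1 : ℤ) < 0 by lia)]
    · rw [v_succ, if_neg (by lia)]
      simp
  rw [show j + 2 = (j + 1) + 1 from rfl, v_succ, v_succ, v_succ, hv0]
  push_cast
  apply mul_left_cancel₀ hn0
  linear_combination key

/-- Raising the degree of the functionals. -/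
lemma add_one_mul_v_succ_left (n k : ℕ) {g : ℝ → ℝ} (hb : BddContOn g) :
    ((n : ℝ) + 1) * v (n + 1) k g = (n + 1 + k) * v n k g - k * v n (k + 1) g := by
  obtain ⟨B, hB⟩ := hb.2
  rcases k with _ | j
  · simp [v_zero]
  · have hgm : AEStronglyMeasurable g (volume.restrict (Ioi 0)) :=
      (hb.1.mono Ioi_subset_Ici_self).aestronglyMeasurable measurableSet_Ioi
    have ig (k : ℤ) : IntegrableOn (fun t => P (n + 2) k t * g t) (Ioi 0) :=
      integrableOn_P_mul (by lia) k hgm fun t ht => hB t (Ioi_subset_Ici_self ht)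
    have h : ((n : ℝ) + 2) * ∫ t in Ioi (0 : ℝ), P (n + 1 + 2) j t * g t =
        (n + 2 + j) * (∫ t in Ioi (0 : ℝ), P (n + 2) j t * g t)
          - (j + 1) * ∫ t in Ioi (0 : ℝ), P (n + 2) (j + 1) t * g t := by
      rw [← integral_const_mul, ← integral_const_mul, ← integral_const_mul,
        ← integral_sub ((ig j).const_mul _) ((ig (j + 1)).const_mul _)]
      refine setIntegral_congr_fun measurableSet_Ioi fun t (ht : 0 < t) => ?_
      have := mul_P_succ (n := n + 2) (by lia) j (by positivity : 1 + t ≠ 0)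
      push_cast at this
      simp only [show n + 1 + 2 = n + 2 + 1 by ring]
      linear_combination g t * this
    rw [v_succ, v_succ, v_succ]
    push_cast
    linear_combination ((n : ℝ) + 1) * h

lemma hasSum_v_mul_P {n : ℕ} (hn : 1 ≤ n) {x : ℝ} (hx : 0 ≤ x) {g : ℝ → ℝ} {B : ℝ}
    (hB : ∀ t ∈ Ici (0 : ℝ), |g t| ≤ B) :
    HasSum (fun k : ℕ => v n k g * P n (k : ℤ) x) (V n g x) :=
  (summable_mul_P hn hx (abs_v_le n · hB)).hasSum

lemma exists_abs_Dt_le {g : ℝ → ℝ} (hg : MemW2 g) : ∃ M, ∀ t ∈ Ici (0 : ℝ), |Dt g t| ≤ M := by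
  obtain ⟨M, hM⟩ := hg.2.2
  refine ⟨M, fun t ht => ?_⟩
  rcases (mem_Ici.1 ht).eq_or_lt with rfl | ht
  · rw [Dt_zero, abs_zero]
    exact (abs_nonneg _).trans (hM 1 (mem_Ioi.2 one_pos))
  · exact hM t ht

lemma mul_V_sub_V_succ {n : ℕ} (hn : 1 ≤ n) {x : ℝ} (hx : 0 ≤ x) {g : ℝ → ℝ}
    (hb : BddContOn g) (hg : MemW2 g) :
    (n : ℝ) * (n + 1) * (V n g x - V (n + 1) g x) = V n (Dt g) x := by
  obtain ⟨B, hB⟩ := hb.2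
  obtain ⟨M, hM⟩ := exists_abs_Dt_le hg
  have hV := (hasSum_v_mul_P hn hx hB).mul_left ((n : ℝ) * (n + 1))
  have hV' := (hasSum_v_mul_P (n := n + 1) (by lia) hx hB).mul_left ((n : ℝ) * (n + 1))
  have hD := hasSum_v_mul_P hn hx hM
  set e : ℕ → ℝ := fun k => (n + 1) * v (n + 1) (k - 1) g * (k * P n (k : ℤ) x) with he
  have hes : Summable e := by
    refine Summable.of_norm_bounded
      ((hasSum_mul_P hn hx).summable.mul_left (((n : ℝ) + 1) * B)) fun k => ?_
    have h0 := P_nonneg n k hx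
    rw [he, norm_mul, norm_mul, Real.norm_of_nonneg (by positivity : (0 : ℝ) ≤ n + 1),
      Real.norm_of_nonneg (by positivity : 0 ≤ (k : ℝ) * P n (k : ℤ) x)]
    have := abs_v_le (n + 1) (k - 1) hB
    rw [Real.norm_eq_abs]
    gcongr
  have he1 : HasSum (fun k => e (k + 1)) (∑' k, e k) := by
    have := (hasSum_nat_add_iff' 1).2 hes.hasSum
    simpa [he] using this
  have hsum := ((hV.sub hV').sub he1).add hes.hasSum
  rw [sub_add_cancel, ← mul_sub] at hsum
  refine hsum.unique (hD.congr_fun fun k => ?_)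
  have h1 := mul_P_succ hn k (by positivity : 1 + x ≠ 0)
  have h2 := add_one_mul_v_succ_left n k hb
  push_cast at h1
  rcases k with _ | j
  · simp only [he, v_zero, Dt_zero] at h1 h2 ⊢
    simp only [zero_add, tsub_self, v_zero]
    push_cast at h1 ⊢
    linear_combination -((n : ℝ) + 1) * g 0 * h1
  · have h3 := add_one_mul_v_succ_left n j hb
    rw [v_Dt hn j hb hg]
    simp only [he, add_tsub_cancel_right]
    push_cast at h1 h2 ⊢
    linear_combination (-((n : ℝ) + 1) * v (n + 1) (j + 1) g) * h1
      - (n + (j + 1)) * P n (j + 1) x * h2 + (j + 1) * P n (j + 1) x * h3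

lemma Dt_P {n : ℕ} (hn : 1 ≤ n) (k : ℤ) {x : ℝ} (hx : 0 < x) :
    Dt (P n k) x = ((k : ℝ) - 1) * (n + (k - 1)) * P n (k - 1) x
      - 2 * (k * (n + k) * P n k x) + (k + 1) * (n + (k + 1)) * P n (k + 1) x := by
  have h1 : deriv (P n k) =ᶠ[nhds x] fun y => n * (P (n + 1) (k - 1) y - P (n + 1) k y) := by
    filter_upwards [Ioi_mem_nhds hx] with y hy using (hasDerivAt_P hn k hy).deriv
  have h2 : HasDerivAt (fun y => n * (P (n + 1) (k - 1) y - P (n + 1) k y)) _ x :=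
    ((hasDerivAt_P (n := n + 1) (by lia) (k - 1) hx).sub
      (hasDerivAt_P (n := n + 1) (by lia) k hx)).const_mul (n : ℝ)
  rw [Dt, h1.deriv_eq, h2.deriv]
  have hx1 : 1 + x ≠ 0 := by positivity
  have p0 := psi_mul_P hn (k - 1) hx1
  have p1 := psi_mul_P hn k hx1
  have p2 := psi_mul_P hn (k + 1) hx1
  rw [add_sub_cancel_right] at p2
  push_cast at p0 p1 p2 ⊢
  linear_combination p0 - 2 * p1 + p2

/-- Summation by parts for a second difference vanishing at the left end. -/
lemma hasSum_mul_second_difference {w : ℕ → ℝ} {σ : ℤ → ℝ} {B : ℝ} (hw : ∀ k, |w k| ≤ B)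
    (hσ : Summable fun k : ℕ => σ k) (h0 : σ 0 = 0) (h1 : σ (-1) = 0) :
    HasSum (fun k : ℕ => w k * (σ (k - 1) - 2 * σ k + σ (k + 1)))
      (∑' j : ℕ, (w (j + 2) - 2 * w (j + 1) + w j) * σ (j + 1)) := by
  have hs : Summable fun j : ℕ => σ (j + 1) := by
    have := (summable_nat_add_iff 1).2 hσ
    simpa using this
  have hm (i : ℕ) : Summable fun j : ℕ => w (j + i) * σ (j + 1) := by
    refine Summable.of_norm_bounded (hs.norm.mul_left B) fun j => ?_
    rw [norm_mul]
    exact mul_le_mul_of_nonneg_right (hw _) (norm_nonneg _)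
  have a2 : HasSum (fun k : ℕ => w k * σ (k - 1)) (∑' j : ℕ, w (j + 2) * σ (j + 1)) := by
    rw [← hasSum_nat_add_iff' 2]
    have : ∑ i ∈ Finset.range 2, w i * σ ((i : ℤ) - 1) = 0 := by
      simp [Finset.sum_range_succ, h0, h1]
    rw [this, sub_zero]
    refine (hm 2).hasSum.congr_fun fun j => ?_
    rw [show ((j + 2 : ℕ) : ℤ) - 1 = j + 1 by push_cast; ring]
  have a1 : HasSum (fun k : ℕ => w k * σ k) (∑' j : ℕ, w (j + 1) * σ (j + 1)) := by
    rw [← hasSum_nat_add_iff' 1]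
    simpa [h0] using (hm 1).hasSum
  have a0 := (hm 0).hasSum
  simp only [add_zero] at a0
  have hL : HasSum (fun j : ℕ => (w (j + 2) - 2 * w (j + 1) + w j) * σ (j + 1)) _ :=
    (((hm 2).hasSum.sub ((hm 1).hasSum.mul_left 2)).add a0).congr_fun fun j => by ring
  rw [hL.tsum_eq]
  exact ((a2.sub (a1.mul_left 2)).add a0).congr_fun fun k => by ring

/-- The operator commutes with the differential operator. -/
lemma hasSum_v_mul_Dt_P {n : ℕ} (hn : 1 ≤ n) {x : ℝ} (hx : 0 < x) {g : ℝ → ℝ}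
    (hb : BddContOn g) (hg : MemW2 g) :
    HasSum (fun k : ℕ => v n k g * Dt (P n (k : ℤ)) x) (V n (Dt g) x) := by
  obtain ⟨B, hB⟩ := hb.2
  obtain ⟨M, hM⟩ := exists_abs_Dt_le hg
  set σ : ℤ → ℝ := fun k => k * (n + k) * P n k x with hσ
  have hs : Summable fun k : ℕ => σ k := by
    refine (((hasSum_mul_P hn hx.le).summable.mul_left (n : ℝ)).add
      (hasSum_sq_mul_P hn hx.le).summable).congr fun k => ?_
    simp only [hσ]
    push_cast
    ring
  have h := hasSum_mul_second_difference (abs_v_le n · hB) hs (by simp [hσ])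
    (by simp [hσ, P_of_neg (show (-1 : ℤ) < 0 by lia)])
  have hD := (hasSum_nat_add_iff' 1).2 (hasSum_v_mul_P hn hx.le hM)
  simp only [Finset.range_one, Finset.sum_singleton, v_zero, Dt_zero, zero_mul, sub_zero] at hD
  have e : ∑' j : ℕ, (v n (j + 2) g - 2 * v n (j + 1) g + v n j g) * σ (j + 1) = V n (Dt g) x := by
    rw [← hD.tsum_eq]
    refine tsum_congr fun j => ?_
    rw [v_Dt hn j hb hg]
    simp only [hσ]
    push_cast
    ring
  rw [e] at h
  refine h.congr_fun fun k => ?_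
  rw [Dt_P hn k hx]
  simp only [hσ]
  push_cast
  ring

lemma Vt_eq {n : ℕ} (hn : 1 ≤ n) {x : ℝ} (hx : 0 < x) {g : ℝ → ℝ}
    (hb : BddContOn g) (hg : MemW2 g) : Vt n g x = V n g x - 1 / n * V n (Dt g) x := by
  obtain ⟨B, hB⟩ := hb.2
  have h := (hasSum_v_mul_P hn hx.le hB).sub ((hasSum_v_mul_Dt_P hn hx hb hg).mul_left (1 / (n : ℝ)))
  rw [← h.tsum_eq, Vt]
  exact tsum_congr fun k => by ring

lemma Vt_zero (n : ℕ) (g : ℝ → ℝ) : Vt n g 0 = g 0 := by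
  rw [Vt, tsum_eq_single 0]
  · simp [v_zero, Dt_zero, P_zero_right]
  · intro k hk
    simp [Dt_zero, P_zero_right, hk]

/-- Two-step telescoping: a sequence with increments `b_m / (m (m+1))`, where `b` has increments
bounded by `M / (m (m+1))`, stays within `M / n²` of its first-order prediction. -/
lemma abs_sub_sub_le_of_telescoping {a b : ℕ → ℝ} {l M : ℝ} {n : ℕ} (hn : 1 ≤ n)
    (ha : ∀ m ≥ n, (m : ℝ) * (m + 1) * (a m - a (m + 1)) = b m)
    (hb : ∀ m ≥ n, (m : ℝ) * (m + 1) * |b m - b (m + 1)| ≤ M)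
    (hl : Tendsto a atTop (nhds l)) : |a n - l - 1 / n * b n| ≤ 1 / (n : ℝ) ^ 2 * M := by
  have hn0 : (0 : ℝ) < n := by positivity
  have hM : 0 ≤ M := (by positivity : (0 : ℝ) ≤ _).trans (hb n le_rfl)
  have key : ∀ m ≥ n, |b m - b n| ≤ M * (1 / n - 1 / m) ∧
      |a n - a m - (1 / n - 1 / m) * b n| ≤ M / n * (1 / n - 1 / m) := by
    intro m hm
    induction m, hm using Nat.le_induction with
    | base => simp
    | succ m hm ih =>
      obtain ⟨ih1, ih2⟩ := ih
      have hm0 : (0 : ℝ) < m := by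
        have : (n : ℝ) ≤ m := by exact_mod_cast hm
        linarith
      have hmm : (0 : ℝ) < m * (m + 1) := by positivity
      have e : (1 : ℝ) / n - 1 / ((m + 1 : ℕ) : ℝ) = (1 / n - 1 / m) + 1 / (m * (m + 1)) := by
        push_cast
        field_simp
        ring
      have hb' : |b m - b (m + 1)| ≤ M * (1 / (m * (m + 1))) := by
        rw [mul_one_div, le_div_iff₀ hmm]
        linarith [hb m hm]
      have ha' : a m - a (m + 1) = 1 / (m * (m + 1)) * b m := by
        rw [← ha m hm]
        field_simp
      rw [e]
      constructor
      · have := abs_sub (b m - b n) (b m - b (m + 1))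
        rw [show b m - b n - (b m - b (m + 1)) = b (m + 1) - b n by ring] at this
        linarith
      · have h1 : a n - a (m + 1) - (1 / n - 1 / m + 1 / (m * (m + 1))) * b n =
            (a n - a m - (1 / n - 1 / m) * b n) + 1 / (m * (m + 1)) * (b m - b n) := by
          linear_combination ha'
        have h2 : |b m - b n| ≤ M / n := by
          refine ih1.trans ?_
          rw [div_eq_mul_one_div M]
          refine mul_le_mul_of_nonneg_left ?_ hM
          have : (0 : ℝ) ≤ 1 / m := by positivity
          linarith
        rw [h1]
        refine (abs_add_le _ _).trans ?_
        rw [abs_mul, abs_of_pos (by positivity : (0 : ℝ) < 1 / (m * (m + 1)))]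
        have := mul_le_mul_of_nonneg_left h2 (by positivity : (0 : ℝ) ≤ 1 / (m * (m + 1)))
        linarith
  have hinv : Tendsto (fun m : ℕ => (1 : ℝ) / n - 1 / m) atTop (nhds (1 / n)) := by
    simpa using (tendsto_const_nhds (x := (1 : ℝ) / n)).sub tendsto_one_div_atTop_nhds_zero_nat
  have h := le_of_tendsto_of_tendsto
    ((tendsto_const_nhds.sub hl).sub (hinv.mul_const (b n))).abs (hinv.const_mul (M / n))
    (by filter_upwards [eventually_ge_atTop n] with m hm using (key m hm).2)
  refine h.trans_eq ?_
  field_simp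

lemma abs_le_supNorm {g : ℝ → ℝ} {B : ℝ} (hB : ∀ t ∈ Ici (0 : ℝ), |g t| ≤ B) {x : ℝ}
    (hx : x ∈ Ici (0 : ℝ)) : |g x| ≤ supNorm g := by
  have hB0 : 0 ≤ B := (abs_nonneg _).trans (hB x hx)
  have hle (y : ℝ) : ⨆ _ : y ∈ Ici (0 : ℝ), |g y| ≤ B := Real.iSup_le (hB y) hB0
  have : ⨆ _ : x ∈ Ici (0 : ℝ), |g x| = |g x| := ciSup_pos hx
  rw [← this]
  exact le_ciSup (f := fun y => ⨆ _ : y ∈ Ici (0 : ℝ), |g y|) ⟨B, by rintro _ ⟨y, rfl⟩; exact hle y⟩ x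

lemma supNorm_nonneg (g : ℝ → ℝ) : 0 ≤ supNorm g :=
  Real.iSup_nonneg fun _ => Real.iSup_nonneg fun _ => abs_nonneg _

lemma supNorm_le {g : ℝ → ℝ} {B : ℝ} (hB0 : 0 ≤ B) (hB : ∀ t ∈ Ici (0 : ℝ), |g t| ≤ B) :
    supNorm g ≤ B :=
  Real.iSup_le (fun t => Real.iSup_le (hB t) hB0) hB0

lemma bddContOn_Dt {f : ℝ → ℝ} (hf : MemW20 f) (hDf : MemW2 (Dt f)) : BddContOn (Dt f) := by
  refine ⟨fun x hx => ?_, exists_abs_Dt_le hf.1⟩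
  rcases (mem_Ici.1 hx).eq_or_lt with rfl | hx
  · rw [← continuousWithinAt_Ioi_iff_Ici, ContinuousWithinAt, Dt_zero]
    exact hf.2
  · exact (hasDerivAt_of_memW2 hDf hx).continuousAt.continuousWithinAt

theorem jackson_type_inequality (n : ℕ) (hn : 2 ≤ n) (f : ℝ → ℝ) (hf : BddContOn f)
    (hfW : MemW20 f) (hDfW : MemW2 (Dt f)) :
    supNorm (fun x => Vt n f x - f x) ≤ (1 / (n : ℝ) ^ 2) * supNorm (Dt (Dt f)) := by
  have hM0 := supNorm_nonneg (Dt (Dt f))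
  obtain ⟨B, hB⟩ := exists_abs_Dt_le hDfW
  have hM : ∀ t ∈ Ici (0 : ℝ), |Dt (Dt f) t| ≤ supNorm (Dt (Dt f)) :=
    fun t ht => abs_le_supNorm hB ht
  refine supNorm_le (by positivity) fun x hx => ?_
  rcases (mem_Ici.1 hx).eq_or_lt with rfl | hx
  · rw [Vt_zero, sub_self, abs_zero]
    positivity
  · rw [Vt_eq (by lia) hx hf hfW.1, sub_right_comm]
    refine abs_sub_sub_le_of_telescoping (a := fun m => V m f x) (b := fun m => V m (Dt f) x)
      (by lia) (fun m hm => mul_V_sub_V_succ (by lia) hx.le hf hfW.1) (fun m hm => ?_)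
      (tendsto_V hf hx.le)
    rw [← abs_of_nonneg (by positivity : (0 : ℝ) ≤ m * (m + 1)), ← abs_mul,
      mul_V_sub_V_succ (by lia) hx.le (bddContOn_Dt hfW hDfW) hDfW]
    exact abs_V_le (by lia) hx.le hM
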